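/- Let V be a finite type of propositional variables and F a set of clauses over V. If F is unsatisfiable, i.e., no total assignment v : V → Bool satisfies all clauses of F, then the empty clause belongs to the resolution closure of F. -/

import Mathlib

/-- A literal is a variable paired with a Boolean polarity. -/
abbrev Lit (V : Type*) := V × Bool

/-- Negation of a literal flips its polarity. -/
def NegLit {V : Type*} (l : Lit V) : Lit V := (l.1, !l.2)

/-- A clause is a finite set of literals. -/
abbrev Clause (V : Type*) := Finset (Lit V)

/-- A total assignment satisfies a literal `(x, b)` iff it maps `x` to `b`. -/
def SatLit {V : Type*} (v : V → Bool) (l : Lit V) : Prop := v l.1 = l.2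

/-- A total assignment satisfies a clause iff it satisfies some literal of it. -/
def SatClause {V : Type*} (v : V → Bool) (C : Clause V) : Prop := ∃ l ∈ C, SatLit v l

/-- A set of clauses entails a clause iff every assignment satisfying all
clauses of the set satisfies the clause. -/
def Entails {V : Type*} (F : Set (Clause V)) (C : Clause V) : Prop :=
  ∀ v : V → Bool, (∀ D ∈ F, SatClause v D) → SatClause v C

/-- The resolution closure of `F`: the smallest set of clauses containing `F`
and closed under binary resolution. -/
inductive ResClosure {V : Type*} [DecidableEq V] (F : Set (Clause V)) : Clause V → Prop
  | base {C : Clause V} : C ∈ F → ResClosure F C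
  | res {C D : Clause V} {ℓ : Lit V} : ResClosure F C → ResClosure F D →
      NegLit ℓ ∈ C → ℓ ∈ D → ResClosure F ((C \ {NegLit ℓ}) ∪ (D \ {ℓ}))

/-- If every assignment falsifies a derivable clause over `insert x S`, then every assignment
falsifies a derivable clause over `S`. -/
theorem ResClosure.exists_falsified_of_insert {V : Type*} [DecidableEq V] {F : Set (Clause V)}
    {x : V} {S : Finset V}
    (h : ∀ v : V → Bool, ∃ C, ResClosure F C ∧ ∀ l ∈ C, l.1 ∈ insert x S ∧ ¬ SatLit v l)
    (v : V → Bool) : ∃ C, ResClosure F C ∧ ∀ l ∈ C, l.1 ∈ S ∧ ¬ SatLit v l := by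
  have key : ∀ b : Bool, ∃ C, ResClosure F C ∧
      ∀ l ∈ C, l = (x, !b) ∨ (l.1 ∈ S ∧ ¬ SatLit v l) := by
    intro b
    obtain ⟨C, hC, hl⟩ := h (Function.update v x b)
    refine ⟨C, hC, fun ⟨y, c⟩ hy => ?_⟩
    obtain ⟨hmem, hsat⟩ := hl _ hy
    by_cases hyx : y = x
    · subst hyx
      left
      cases b <;> cases c <;> simp_all [SatLit]
    · right
      simp_all [SatLit]
  obtain ⟨C, hC, hCl⟩ := key true
  obtain ⟨D, hD, hDl⟩ := key false
  by_cases hxC : NegLit (x, true) ∈ C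
  · by_cases hxD : (x, true) ∈ D
    · refine ⟨_, ResClosure.res hC hD hxC hxD, fun l hl => ?_⟩
      simp only [Finset.mem_union, Finset.mem_sdiff, Finset.mem_singleton] at hl
      rcases hl with ⟨hl, hne⟩ | ⟨hl, hne⟩
      · exact (hCl l hl).resolve_left hne
      · exact (hDl l hl).resolve_left hne
    · exact ⟨D, hD, fun l hl => (hDl l hl).resolve_left fun e => hxD (e ▸ hl)⟩
  · exact ⟨C, hC, fun l hl => (hCl l hl).resolve_left fun e => hxC (by rwa [e] at hl)⟩

/-- Completeness of resolution: over a finite type of variables, if `F` is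
unsatisfiable then the empty clause belongs to its resolution closure. -/
theorem resolution_complete {V : Type*} [Fintype V] [DecidableEq V]
    (F : Set (Clause V)) (h : ¬ ∃ v : V → Bool, ∀ C ∈ F, SatClause v C) :
    ResClosure F (∅ : Clause V) := by
  have descend : ∀ S : Finset V,
      (∀ v : V → Bool, ∃ C, ResClosure F C ∧ ∀ l ∈ C, l.1 ∈ S ∧ ¬ SatLit v l) →
      ResClosure F ∅ := by
    intro S
    induction S using Finset.induction_on with
    | empty =>
      intro hS
      obtain ⟨C, hC, hl⟩ := hS fun _ => true
      rwa [Finset.eq_empty_of_forall_notMem fun l hlC => Finset.notMem_empty _ (hl l hlC).1] at hC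
    | insert x S _ ih => exact fun hS => ih (ResClosure.exists_falsified_of_insert hS)
  refine descend Finset.univ fun v => ?_
  by_contra hv
  refine h ⟨v, fun C hC => ?_⟩
  by_contra hsat
  exact hv ⟨C, .base hC, fun l hl => ⟨Finset.mem_univ _, fun hs => hsat ⟨l, hl, hs⟩⟩⟩
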